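/- Let Λ be a net of quadrics in a,b,c,d,e that is ρ1-, ρ2-, ρ3- and ρ4-semistable, and let (Q1,Q2,Q3) be a normalized basis of Λ. Then: (i) Q3 is not a scalar multiple of e²; (ii) not all of Q1,Q2,Q3 lie in (d,e), and moreover either not both Q2 and Q3 lie in (d,e), or Q3 does not lie in span{d²,de,e²}; (iii) not both Q2 and Q3 lie in (c,d,e)², and moreover either not all of Q1,Q2,Q3 lie in (c,d,e), or Q3 does not lie in (c,d,e)²; (iv) either in_lex(Q1)=a², or both in_lex(Q1) and in_lex(Q2) are divisible by a. -/

import Mathlib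

open MvPolynomial

/-- The space of polynomials in the five variables `a,b,c,d,e` (indexed `0,…,4`). -/
abbrev Quin : Type := MvPolynomial (Fin 5) ℂ

/-- `m` is (the exponent vector of) a quadratic monomial. -/
def QuadMon (m : Fin 5 →₀ ℕ) : Prop := (m.sum fun _ n => n) = 2

/-- A net of quadrics: a 3-dimensional space of quadratic forms. -/
def IsNet (Λ : Submodule ℂ Quin) : Prop :=
  Module.finrank ℂ Λ = 3 ∧ ∀ Q ∈ Λ, MvPolynomial.IsHomogeneous Q 2

/-- The `ρ`-weight of a monomial. -/
def wt (ρ : Fin 5 → ℤ) (m : Fin 5 →₀ ℕ) : ℤ := ∑ i, (m i : ℤ) * ρ i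

/-- `Λ` is semistable with respect to the weight vector `ρ`: there are three distinct
quadratic monomials with total `ρ`-weight `≥ 0` such that the corresponding coefficient
map `Λ → ℂ³` is bijective. -/
def SemistableWrt (Λ : Submodule ℂ Quin) (ρ : Fin 5 → ℤ) : Prop :=
  ∃ m1 m2 m3 : Fin 5 →₀ ℕ, m1 ≠ m2 ∧ m1 ≠ m3 ∧ m2 ≠ m3 ∧
    QuadMon m1 ∧ QuadMon m2 ∧ QuadMon m3 ∧
    0 ≤ wt ρ m1 + wt ρ m2 + wt ρ m3 ∧
    Function.Bijective (fun Q : Λ =>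
      (![MvPolynomial.coeff m1 (Q : Quin), MvPolynomial.coeff m2 (Q : Quin),
         MvPolynomial.coeff m3 (Q : Quin)] : Fin 3 → ℂ))

/-- The twelve distinguished weight vectors `ρ1,…,ρ12`. -/
def rho : Fin 12 → Fin 5 → ℤ :=
  ![![1,1,1,1,-4], ![2,2,2,-3,-3], ![3,3,-2,-2,-2], ![4,-1,-1,-1,-1],
    ![3,3,3,-2,-7], ![4,4,-1,-1,-6], ![9,4,-1,-6,-6], ![7,2,2,-3,-8],
    ![12,7,2,-8,-13], ![9,4,-1,-1,-11], ![14,4,-1,-6,-11], ![13,8,3,-7,-17]]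

/-- A normalized weight vector: nonincreasing, sums to zero and not identically zero. -/
def IsNormalized (ρ : Fin 5 → ℤ) : Prop :=
  (∀ i j : Fin 5, i ≤ j → ρ j ≤ ρ i) ∧ (∑ i, ρ i) = 0 ∧ ρ ≠ 0

/-- Linear substitution of variables by the matrix `g`, as a linear map on polynomials. -/
noncomputable def substMap (g : Matrix (Fin 5) (Fin 5) ℂ) : Quin →ₗ[ℂ] Quin :=
  (MvPolynomial.aeval fun i => ∑ j, MvPolynomial.C (g i j) * MvPolynomial.X j).toLinearMap

/-- Semistability of a net (Hilbert–Mumford criterion for `SL(5)`). -/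
def Semistable (Λ : Submodule ℂ Quin) : Prop :=
  ∀ (g : Matrix.GeneralLinearGroup (Fin 5) ℂ) (ρ : Fin 5 → ℤ), IsNormalized ρ →
    SemistableWrt (Submodule.map (substMap (g : Matrix (Fin 5) (Fin 5) ℂ)) Λ) ρ

/-- The symmetric matrix of a quadratic form. -/
noncomputable def quadMatrix (Q : Quin) : Matrix (Fin 5) (Fin 5) ℂ :=
  Matrix.of fun i j =>
    if i = j then MvPolynomial.coeff (Finsupp.single i 2) Q
    else (1/2) * MvPolynomial.coeff (Finsupp.single i 1 + Finsupp.single j 1) Q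

/-- The discriminant quintic `det (x·A1 + y·A2 + z·A3)` of a net with basis `Q1,Q2,Q3`. -/
noncomputable def netDisc (Q1 Q2 Q3 : Quin) : MvPolynomial (Fin 3) ℂ :=
  Matrix.det (Matrix.of fun i j : Fin 5 =>
    MvPolynomial.C (quadMatrix Q1 i j) * MvPolynomial.X 0 +
    MvPolynomial.C (quadMatrix Q2 i j) * MvPolynomial.X 1 +
    MvPolynomial.C (quadMatrix Q3 i j) * MvPolynomial.X 2)

/-- The net lies on a smooth quartic del Pezzo surface. -/
def OnSmoothDelPezzo (Λ : Submodule ℂ Quin) : Prop :=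
  ∃ P1 P2 : Quin, P1 ∈ Λ ∧ P2 ∈ Λ ∧ LinearIndependent ℂ ![P1, P2] ∧
    ∀ v : Fin 5 → ℂ, v ≠ 0 → MvPolynomial.eval v P1 = 0 → MvPolynomial.eval v P2 = 0 →
      LinearIndependent ℂ
        ![fun i => MvPolynomial.eval v (MvPolynomial.pderiv i P1),
          fun i => MvPolynomial.eval v (MvPolynomial.pderiv i P2)]

/-- Lexicographic order on monomials with `a ≻ b ≻ c ≻ d ≻ e` (variable `0` most significant). -/
def lexGT (m m' : Fin 5 →₀ ℕ) : Prop :=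
  ∃ i : Fin 5, m' i < m i ∧ ∀ j : Fin 5, j < i → m j = m' j

/-- `m` is the lexicographically largest monomial appearing in `Q`. -/
def IsLexInitial (Q : Quin) (m : Fin 5 →₀ ℕ) : Prop :=
  MvPolynomial.coeff m Q ≠ 0 ∧
    ∀ m' : Fin 5 →₀ ℕ, MvPolynomial.coeff m' Q ≠ 0 → m' = m ∨ lexGT m m'

/-- The span of the quadratic monomials whose exponent vectors satisfy `P`. -/
noncomputable def monSpan (P : (Fin 5 →₀ ℕ) → Prop) : Submodule ℂ Quin :=
  Submodule.span ℂ {Q : Quin | ∃ m : Fin 5 →₀ ℕ, QuadMon m ∧ P m ∧ Q = MvPolynomial.monomial m 1}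

/-- `(d,e)`: span of the quadratic monomials divisible by `d` or `e`. -/
noncomputable def idealDE : Submodule ℂ Quin := monSpan fun m => m 3 ≠ 0 ∨ m 4 ≠ 0

/-- `(d,e)² = span{d², de, e²}`. -/
noncomputable def sqDE : Submodule ℂ Quin := monSpan fun m => m 0 = 0 ∧ m 1 = 0 ∧ m 2 = 0

/-- `(c,d,e)`: span of the quadratic monomials divisible by `c`, `d` or `e`. -/
noncomputable def idealCDE : Submodule ℂ Quin := monSpan fun m => m 2 ≠ 0 ∨ m 3 ≠ 0 ∨ m 4 ≠ 0

/-- `(c,d,e)²`: span of the quadratic monomials in `c,d,e` only. -/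
noncomputable def sqCDE : Submodule ℂ Quin := monSpan fun m => m 0 = 0 ∧ m 1 = 0

/-- A quadratic monomial has exponents summing to `2`. -/
lemma QuadMon.sum_eq {m : Fin 5 →₀ ℕ} (h : QuadMon m) : m 0 + m 1 + m 2 + m 3 + m 4 = 2 := by
  have h' : (m.sum fun _ n => n) = 2 := h
  rwa [Finsupp.sum_fintype _ _ fun _ => rfl, Fin.sum_univ_five] at h'

/-- Every monomial appearing in an element of `monSpan P` satisfies `P`. -/
lemma of_mem_monSpan {P : (Fin 5 →₀ ℕ) → Prop} {Q : Quin} (hQ : Q ∈ monSpan P)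
    {m : Fin 5 →₀ ℕ} (hm : coeff m Q ≠ 0) : P m := by
  by_contra hP
  refine hm ?_
  have hle : monSpan P ≤ LinearMap.ker (lcoeff ℂ m) := by
    refine Submodule.span_le.2 ?_
    rintro _ ⟨m', -, hm', rfl⟩
    have hne : m' ≠ m := by rintro rfl; exact hP hm'
    simp [coeff_monomial, hne]
  simpa using hle hQ

lemma lexGT.apply_zero_le {m m' : Fin 5 →₀ ℕ} (h : lexGT m m') : m' 0 ≤ m 0 := by
  obtain ⟨i, hi, hj⟩ := h
  rcases eq_or_ne i 0 with rfl | hi0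
  · exact hi.le
  · exact (hj 0 (Fin.pos_iff_ne_zero.2 hi0)).ge

lemma IsLexInitial.apply_zero_le {Q : Quin} {m n : Fin 5 →₀ ℕ} (h : IsLexInitial Q m)
    (hn : coeff n Q ≠ 0) : n 0 ≤ m 0 := by
  rcases h.2 n hn with rfl | h
  · exact le_rfl
  · exact h.apply_zero_le

/-- A nonzero Plücker coordinate of nonnegative weight yields one nonzero coefficient in each
member of a basis, at monomials of nonnegative total weight. -/
lemma SemistableWrt.exists_coeff_ne_zero {Λ : Submodule ℂ Quin} {ρ : Fin 5 → ℤ}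
    (h : SemistableWrt Λ ρ) {Q : Fin 3 → Quin} (hQ : ∀ i, Q i ∈ Λ)
    (hli : LinearIndependent ℂ Q) :
    ∃ n : Fin 3 → Fin 5 →₀ ℕ, (∀ i, QuadMon (n i)) ∧ (∀ i, coeff (n i) (Q i) ≠ 0) ∧
      0 ≤ ∑ i, wt ρ (n i) := by
  obtain ⟨m1, m2, m3, -, -, -, q1, q2, q3, hw, hbij⟩ := h
  set m : Fin 3 → Fin 5 →₀ ℕ := ![m1, m2, m3] with hm
  have hdet : (Matrix.of fun i j => coeff (m i) (Q j)).det ≠ 0 := by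
    intro h0
    obtain ⟨v, hv, hMv⟩ := Matrix.exists_mulVec_eq_zero_iff.2 h0
    have hR : ∑ j, v j • Q j ∈ Λ := Submodule.sum_mem _ fun j _ => Λ.smul_mem _ (hQ j)
    have hcoeff (i : Fin 3) : coeff (m i) (∑ j, v j • Q j) = 0 := by
      have := congrFun hMv i
      simpa [Matrix.mulVec, dotProduct, coeff_sum, mul_comm] using this
    have hR0 : (⟨_, hR⟩ : Λ) = 0 := by
      refine hbij.1 ?_
      ext i
      have := hcoeff i
      fin_cases i <;> simpa [hm] using this
    exact hv (funext (Fintype.linearIndependent_iff.1 hli v (congrArg Subtype.val hR0)))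
  rw [Matrix.det_apply'] at hdet
  obtain ⟨σ, -, hσ⟩ := Finset.exists_ne_zero_of_sum_ne_zero hdet
  refine ⟨m ∘ σ, fun i => ?_, fun i => ?_, ?_⟩
  · have hq : ∀ j, QuadMon (m j) := by
      intro j
      fin_cases j <;> assumption
    exact hq (σ i)
  · exact Finset.prod_ne_zero_iff.1 (right_ne_zero_of_mul hσ) i (Finset.mem_univ i)
  · simp only [Function.comp_apply]
    rw [Equiv.sum_comp σ fun i => wt ρ (m i), Fin.sum_univ_three]
    exact hw

/-- Properties of a normalized basis of a net that is `ρ1`-, `ρ2`-, `ρ3`-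
and `ρ4`-semistable. -/
theorem normalized_basis_properties (Λ : Submodule ℂ Quin) (hΛ : IsNet Λ)
    (Q1 Q2 Q3 : Quin) (hQ1 : Q1 ∈ Λ) (hQ2 : Q2 ∈ Λ) (hQ3 : Q3 ∈ Λ)
    (hli : LinearIndependent ℂ ![Q1, Q2, Q3])
    (hspan : Submodule.span ℂ {Q1, Q2, Q3} = Λ)
    (m1 m2 m3 : Fin 5 →₀ ℕ)
    (hm1 : IsLexInitial Q1 m1) (hm2 : IsLexInitial Q2 m2) (hm3 : IsLexInitial Q3 m3)
    (h12 : lexGT m1 m2) (h23 : lexGT m2 m3)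
    (hs1 : SemistableWrt Λ (rho 0)) (hs2 : SemistableWrt Λ (rho 1))
    (hs3 : SemistableWrt Λ (rho 2)) (hs4 : SemistableWrt Λ (rho 3)) :
    -- (i) `Q3` is not a scalar multiple of `e²`
    (∀ c : ℂ, Q3 ≠ MvPolynomial.C c * MvPolynomial.X 4 ^ 2) ∧
    -- (ii) not all of `Q1,Q2,Q3` lie in `(d,e)`; and either not both `Q2,Q3` lie in `(d,e)`,
    -- or `Q3 ∉ (d,e)²`
    (¬(Q1 ∈ idealDE ∧ Q2 ∈ idealDE ∧ Q3 ∈ idealDE) ∧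
      (¬(Q2 ∈ idealDE ∧ Q3 ∈ idealDE) ∨ Q3 ∉ sqDE)) ∧
    -- (iii) not both `Q2,Q3` lie in `(c,d,e)²`; and either not all of `Q1,Q2,Q3` lie in
    -- `(c,d,e)`, or `Q3 ∉ (c,d,e)²`
    (¬(Q2 ∈ sqCDE ∧ Q3 ∈ sqCDE) ∧
      (¬(Q1 ∈ idealCDE ∧ Q2 ∈ idealCDE ∧ Q3 ∈ idealCDE) ∨ Q3 ∉ sqCDE)) ∧
    -- (iv) `in_lex(Q1) = a²`, or both `in_lex(Q1)` and `in_lex(Q2)` are divisible by `a`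
    (m1 = Finsupp.single 0 2 ∨ (m1 0 ≠ 0 ∧ m2 0 ≠ 0)) := by
  have key {ρ : Fin 5 → ℤ} (h : SemistableWrt Λ ρ) :
      ∃ n1 n2 n3 : Fin 5 →₀ ℕ, n1 0 + n1 1 + n1 2 + n1 3 + n1 4 = 2 ∧
        n2 0 + n2 1 + n2 2 + n2 3 + n2 4 = 2 ∧ n3 0 + n3 1 + n3 2 + n3 3 + n3 4 = 2 ∧
        coeff n1 Q1 ≠ 0 ∧ coeff n2 Q2 ≠ 0 ∧ coeff n3 Q3 ≠ 0 ∧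
        0 ≤ wt ρ n1 + wt ρ n2 + wt ρ n3 := by
    have hQ : ∀ i, ![Q1, Q2, Q3] i ∈ Λ := by
      intro i
      fin_cases i <;> assumption
    obtain ⟨n, hq, hc, hw⟩ := h.exists_coeff_ne_zero hQ hli
    rw [Fin.sum_univ_three] at hw
    exact ⟨n 0, n 1, n 2, (hq 0).sum_eq, (hq 1).sum_eq, (hq 2).sum_eq, hc 0, hc 1, hc 2, hw⟩
  refine ⟨?_, ?_, ?_, ?_⟩
  · rintro c rfl
    obtain ⟨n1, n2, n3, s1, s2, s3, -, -, c3, hw⟩ := key hs1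
    have hn3 : n3 = Finsupp.single 4 2 := by
      by_contra hne
      refine c3 ?_
      rw [coeff_C_mul, coeff_X_pow, if_neg (Ne.symm hne), mul_zero]
    have h4 : n3 4 = 2 := by simp [hn3]
    simp [wt, rho, Fin.sum_univ_five] at hw
    omega
  · obtain ⟨n1, n2, n3, s1, s2, s3, c1, c2, c3, hw⟩ := key hs2
    simp [wt, rho, Fin.sum_univ_five] at hw
    constructor
    · rintro ⟨h1, h2, h3⟩
      have p1 := of_mem_monSpan h1 c1
      have p2 := of_mem_monSpan h2 c2
      have p3 := of_mem_monSpan h3 c3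
      omega
    · by_contra! hcon
      obtain ⟨⟨h2, -⟩, h3⟩ := hcon
      have p2 := of_mem_monSpan h2 c2
      have p3 := of_mem_monSpan h3 c3
      omega
  · obtain ⟨n1, n2, n3, s1, s2, s3, c1, c2, c3, hw⟩ := key hs3
    simp [wt, rho, Fin.sum_univ_five] at hw
    constructor
    · rintro ⟨h2, h3⟩
      have p2 := of_mem_monSpan h2 c2
      have p3 := of_mem_monSpan h3 c3
      omega
    · by_contra! hcon
      obtain ⟨⟨h1, h2, -⟩, h3⟩ := hcon
      have p1 := of_mem_monSpan h1 c1
      have p2 := of_mem_monSpan h2 c2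
      have p3 := of_mem_monSpan h3 c3
      omega
  · obtain ⟨n1, n2, n3, s1, s2, s3, c1, c2, c3, hw⟩ := key hs4
    simp [wt, rho, Fin.sum_univ_five] at hw
    have d1 := hm1.apply_zero_le c1
    have d2 := hm2.apply_zero_le c2
    have d3 := hm3.apply_zero_le c3
    have e12 := h12.apply_zero_le
    have e23 := h23.apply_zero_le
    have hdeg : m1.degree = 2 := by
      by_contra hne
      exact hm1.1 ((hΛ.2 Q1 hQ1).coeff_eq_zero hne)
    rw [Finsupp.degree_eq_sum, Fin.sum_univ_five] at hdeg
    by_cases h0 : m1 0 = 2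
    · left
      ext i
      fin_cases i <;> simp <;> omega
    · right
      omega
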